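/- Let P : g → g be ad-equivariant. Then for every integer k ≥ 0 and all x, y, z ∈ g: [z, dᵏP(x).y⁽ᵏ⁾] = d^{k+1}P(x).([z,x], y,…,y) + k·dᵏP(x).([z,y], y,…,y), where in the first term the (k+1)-st derivative at x is evaluated at [z,x] together with k copies of y, and in the second term the k-th derivative at x is evaluated at [z,y] together with (k−1) copies of y. -/

import Mathlib

section IteratedDerivatives

open scoped ContDiff

variable {𝕜 E F : Type*} [RCLike 𝕜] [NormedAddCommGroup E] [NormedSpace 𝕜 E]
  [NormedAddCommGroup F] [NormedSpace 𝕜 F]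

theorem ContDiff.iteratedFDeriv_apply_const {f : E → F} (hf : ContDiff 𝕜 ∞ f) (k : ℕ)
    (m : Fin k → E) : ContDiff 𝕜 ∞ (fun x => iteratedFDeriv 𝕜 k f x m) :=
  (ContinuousMultilinearMap.apply 𝕜 (fun _ : Fin k => E) F m).contDiff.comp
    (hf.iteratedFDeriv_right (by exact_mod_cast le_top))

theorem ContDiff.iteratedFDeriv_succ_apply_cons {f : E → F} (hf : ContDiff 𝕜 ∞ f) (k : ℕ)
    (x v : E) (m : Fin k → E) :
    iteratedFDeriv 𝕜 (k + 1) f x (Fin.cons v m)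
      = fderiv 𝕜 (fun x => iteratedFDeriv 𝕜 k f x m) x v := by
  have hd : DifferentiableAt 𝕜 (iteratedFDeriv 𝕜 k f) x :=
    ((hf.iteratedFDeriv_right (m := ∞) (by exact_mod_cast le_top)).differentiable
      (by simp)).differentiableAt
  rw [hd.iteratedFDeriv_succ_apply_left']
  simp

/-- The directional derivatives of a smooth map in two constant directions commute. -/
theorem ContDiff.fderiv_fderiv_apply_comm {f : E → F} (hf : ContDiff 𝕜 ∞ f) (x v w : E) :
    fderiv 𝕜 (fun x => fderiv 𝕜 f x v) x w = fderiv 𝕜 (fun x => fderiv 𝕜 f x w) x v := by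
  have hd : DifferentiableAt 𝕜 (fderiv 𝕜 f) x :=
    ((hf.fderiv_right (m := ∞) (by simp)).differentiable (by simp)).differentiableAt
  have hs : IsSymmSndFDerivAt 𝕜 f x :=
    hf.contDiffAt.isSymmSndFDerivAt (by
      rw [minSmoothness_of_isRCLikeNormedField]; exact WithTop.coe_le_coe.2 (le_top : (2 : ℕ∞) ≤ ⊤))
  rw [fderiv_clm_apply hd (by fun_prop), fderiv_clm_apply hd (by fun_prop)]
  simpa using hs.eq w v

/-- Differentiating the identity `A (f x) = f' x (B x) + r x` in the direction `y`. -/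
theorem ContDiff.map_fderiv_apply_eq {f r : E → F} (hf : ContDiff 𝕜 ∞ f)
    (hr : Differentiable 𝕜 r) (A : F →L[𝕜] F) (B : E →L[𝕜] E)
    (h : ∀ x, A (f x) = fderiv 𝕜 f x (B x) + r x) (x y : E) :
    A (fderiv 𝕜 f x y) = fderiv 𝕜 (fun x => fderiv 𝕜 f x y) x (B x)
      + (fderiv 𝕜 f x (B y) + fderiv 𝕜 r x y) := by
  have hd : DifferentiableAt 𝕜 (fderiv 𝕜 f) x :=
    ((hf.fderiv_right (m := ∞) (by simp)).differentiable (by simp)).differentiableAt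
  have hfd : DifferentiableAt 𝕜 f x := (hf.differentiable (by simp)).differentiableAt
  have hleft : HasFDerivAt (fun x => A (f x)) (A.comp (fderiv 𝕜 f x)) x :=
    A.hasFDerivAt.comp x hfd.hasFDerivAt
  have hright := (hd.hasFDerivAt.clm_apply (B.hasFDerivAt (x := x))).add (hr x).hasFDerivAt
  rw [funext h] at hleft
  have key := DFunLike.congr_fun (hleft.unique hright) y
  have hcomm := hf.fderiv_fderiv_apply_comm x (B x) y
  rw [fderiv_clm_apply hd (by fun_prop)] at hcomm
  simp at key hcomm
  rw [key, ← hcomm]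
  abel

theorem ContDiff.map_iteratedFDeriv_eq {f : E → F} (hf : ContDiff 𝕜 ∞ f) (A : F →L[𝕜] F)
    (B : E →L[𝕜] E) (h : ∀ x, A (f x) = fderiv 𝕜 f x (B x)) (y : E) (k : ℕ) (x : E) :
    A (iteratedFDeriv 𝕜 k f x (fun _ => y))
      = iteratedFDeriv 𝕜 (k + 1) f x (Fin.cons (B x) (fun _ => y))
        + (k : 𝕜) • iteratedFDeriv 𝕜 k f x (fun i => if (i : ℕ) = 0 then B y else y) := by
  have hcons (j : ℕ) (v : E) : (fun i : Fin (j + 1) => if (i : ℕ) = 0 then v else y)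
      = Fin.cons v (fun _ => y) := by
    funext i
    refine Fin.cases ?_ (fun i => ?_) i <;> simp
  have hsucc (j : ℕ) : (fun x => iteratedFDeriv 𝕜 (j + 1) f x (fun _ => y))
      = fun x => fderiv 𝕜 (fun x => iteratedFDeriv 𝕜 j f x (fun _ => y)) x y := by
    funext x
    rw [← hf.iteratedFDeriv_succ_apply_cons]
    congr 1
    funext i
    refine Fin.cases ?_ (fun i => ?_) i <;> simp
  induction k generalizing x with
  | zero => simp [h, hf.iteratedFDeriv_succ_apply_cons]
  | succ k ih =>
    have hfk := hf.iteratedFDeriv_apply_const (𝕜 := 𝕜) k (fun _ => y)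
    have hrk := hf.iteratedFDeriv_apply_const (𝕜 := 𝕜) k
      (fun i => if (i : ℕ) = 0 then B y else y)
    have hrd : Differentiable 𝕜 (fun x => iteratedFDeriv 𝕜 k f x
      (fun i => if (i : ℕ) = 0 then B y else y)) := hrk.differentiable (by simp)
    simp only [hf.iteratedFDeriv_succ_apply_cons] at ih
    have key := hfk.map_fderiv_apply_eq (hrd.const_smul (k : 𝕜)) A B ih x y
    have hrest : fderiv 𝕜 ((k : 𝕜) • fun x => iteratedFDeriv 𝕜 k f x
          (fun i => if (i : ℕ) = 0 then B y else y)) x y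
        = (k : 𝕜) • fderiv 𝕜 (fun x => iteratedFDeriv 𝕜 k f x (fun _ => y)) x (B y) := by
      rw [fderiv_const_smul (hrd x)]
      cases k with
      | zero => simp
      | succ j =>
        have hfj := hf.iteratedFDeriv_apply_const (𝕜 := 𝕜) j (fun _ => y)
        simp only [hcons, hf.iteratedFDeriv_succ_apply_cons, hsucc,
          smul_apply]
        rw [hfj.fderiv_fderiv_apply_comm]
    rw [hrest] at key
    rw [hcons, hf.iteratedFDeriv_succ_apply_cons, hf.iteratedFDeriv_succ_apply_cons, hsucc,
      congrFun (hsucc k) x, key]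
    push_cast
    module

end IteratedDerivatives

theorem stmt {g : Type*} [NormedAddCommGroup g] [NormedSpace ℂ g] [FiniteDimensional ℂ g]
    -- `lie` is the Lie bracket of the finite-dimensional complex Lie algebra `g`,
    -- given as bilinear data so that it is compatible with the normed space structure.
    (lie : g →ₗ[ℂ] g →ₗ[ℂ] g)
    (lie_self : ∀ x : g, lie x x = 0)
    (lie_jacobi : ∀ x y z : g, lie x (lie y z) = lie (lie x y) z + lie y (lie x z))
    (P : g → g) (hP : ContDiff ℂ ⊤ P)
    (hPeq : ∀ x y : g, fderiv ℂ P x (lie y x) = lie y (P x))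
    (k : ℕ) (x y z : g) :
    lie z (iteratedFDeriv ℂ k P x (fun _ => y))
      = iteratedFDeriv ℂ (k + 1) P x (Fin.cons (lie z x) (fun _ => y))
        + (k : ℂ) • iteratedFDeriv ℂ k P x (fun i => if (i : ℕ) = 0 then lie z y else y) := by
  exact (hP.of_le le_top).map_iteratedFDeriv_eq (lie z).toContinuousLinearMap
    (lie z).toContinuousLinearMap (fun x => (hPeq x z).symm) y k x
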